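/- arXiv:2401.12194 — 6 statements merged into one kernel-verified Lean document; each statement's English description precedes it below -/
import Mathlib

section
/- Wronskian determinant formula (Lemma 2.1, scalar part): For every s > 0, det P(s) = ( ∏_{0 ≤ i < j ≤ κ} (α_i − α_j) / ∏_{i=0}^{κ} ∏_{j=0}^{κ} (1 + i + α_j) ) · s^{(κ+1)(κ+2)/2 + Σ_{i=0}^{κ} α_i}. -/
open Finset

lemma aux_det (n : ℕ) (α : Fin n → ℝ) (p : Fin n → Polynomial ℝ)
    (h1 : ∀ i, (p i).natDegree = i) (h2 : ∀ i, (p i).Monic) :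
    (Matrix.of fun i j : Fin n => (p (Fin.rev i)).eval (α j)).det
      = ∏ i : Fin n, ∏ j ∈ Finset.Ioi i, (α i - α j) := by
  have h := Matrix.det_eval_matrixOfPolynomials_eq_det_vandermonde (fun i => α (Fin.rev i)) p h1 h2
  have e1 : (Matrix.of fun i j : Fin n => (p (Fin.rev i)).eval (α j)).det
      = (Matrix.of fun i j : Fin n => (p j).eval (α (Fin.rev i))).det := by
    rw [← Matrix.det_transpose, ← Matrix.det_submatrix_equiv_self Fin.revPerm]
    congr 1
    ext i j
    simp
  have e2 : (Matrix.vandermonde (fun i => α (Fin.rev i))).det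
      = (Matrix.projVandermonde (fun _ => 1) α).det := by
    rw [← Matrix.det_submatrix_equiv_self Fin.revPerm (Matrix.projVandermonde _ _)]
    congr 1
    ext i j
    simp [Matrix.projVandermonde_apply, Matrix.vandermonde_apply]
  rw [e1, ← h, e2, Matrix.det_projVandermonde]
  simp

/-- **Wronskian determinant formula (Lemma 2.1, scalar part).**
For `κ ∈ ℕ`, `α₀, …, α_κ ∈ (−1,0)`, `p_{i,j} = (1+α_j)⋯(1+i+α_j)` and
`P(s)_{i,j} = s^{1+α_j+i}/p_{i,j}` (real powers, `s > 0`), one has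
`det P(s) = (∏_{i<j}(α_i−α_j) / ∏_{i,j}(1+i+α_j)) · s^{(κ+1)(κ+2)/2 + Σ α_i}`. -/
theorem det_wronskian_scalar (κ : ℕ) (α : Fin (κ + 1) → ℝ)
    (hα : ∀ i, α i ∈ Set.Ioo (-1 : ℝ) 0) (s : ℝ) (hs : 0 < s) :
    (Matrix.of fun i j : Fin (κ + 1) =>
        s ^ ((1 : ℝ) + α j + (i : ℕ)) /
          ∏ k ∈ Finset.range ((i : ℕ) + 1), ((1 : ℝ) + (k : ℝ) + α j)).det
      = ((∏ i : Fin (κ + 1), ∏ j ∈ Finset.Ioi i, (α i - α j)) /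
            ∏ i : Fin (κ + 1), ∏ j : Fin (κ + 1), ((1 : ℝ) + (i : ℕ) + α j)) *
          s ^ ((((κ : ℝ) + 1) * ((κ : ℝ) + 2)) / 2 + ∑ i, α i) := by
  have hpos : ∀ (k : ℕ) j, (1 : ℝ) + k + α j ≠ 0 := by
    intro k j
    have := (hα j).1
    have : (0 : ℝ) ≤ k := Nat.cast_nonneg k
    exact ne_of_gt (by linarith)
  let p : Fin (κ + 1) → Polynomial ℝ := fun i =>
    ∏ m ∈ Finset.range (i : ℕ), (Polynomial.X + Polynomial.C (1 + ((κ - m : ℕ) : ℝ)))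
  have hm : ∀ i, (p i).Monic := fun i =>
    Polynomial.monic_prod_of_monic _ _ fun m _ => Polynomial.monic_X_add_C _
  have hd : ∀ i, (p i).natDegree = i := by
    intro i
    simp only [p]
    rw [Polynomial.natDegree_prod_of_monic _ _ fun m _ => Polynomial.monic_X_add_C _]
    simp only [Polynomial.natDegree_X_add_C]
    simp
  have hprod : ∀ (m : ℕ) (x : ℝ), m ≤ κ →
      (∏ k ∈ Finset.range (κ - m + 1), ((1 : ℝ) + k + x)) *
        ∏ l ∈ Finset.range m, (x + (1 + ((κ - l : ℕ) : ℝ)))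
        = ∏ k ∈ Finset.range (κ + 1), ((1 : ℝ) + k + x) := by
    intro m x
    induction m with
    | zero => simp
    | succ m ih =>
      intro hmk
      rw [← ih (by omega), Finset.prod_range_succ _ m]
      have : κ - m = κ - (m + 1) + 1 := by omega
      rw [this, Finset.prod_range_succ _ (κ - (m + 1) + 1)]
      ring
  have hM : (Matrix.of fun i j : Fin (κ + 1) =>
        s ^ ((1 : ℝ) + α j + (i : ℕ)) /
          ∏ k ∈ Finset.range ((i : ℕ) + 1), ((1 : ℝ) + (k : ℝ) + α j))
      = Matrix.of fun i j : Fin (κ + 1) => s ^ ((i : ℕ) : ℝ) *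
        (Matrix.of fun i j : Fin (κ + 1) =>
          (s ^ (1 + α j) / ∏ k ∈ Finset.range (κ + 1), ((1 : ℝ) + k + α j)) *
          (Matrix.of fun i j : Fin (κ + 1) => (p (Fin.rev i)).eval (α j)) i j) i j := by
    ext i j
    simp only [Matrix.of_apply, p, Polynomial.eval_prod, Polynomial.eval_add, Polynomial.eval_X,
      Polynomial.eval_C]
    have h := hprod (Fin.rev i : Fin (κ + 1)) (α j) (by omega)
    have hi : κ - ((Fin.rev i : Fin (κ + 1)) : ℕ) = i := by
      rw [Fin.val_rev]; omega
    rw [hi] at h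
    have n1 : ∏ k ∈ Finset.range (κ + 1), ((1 : ℝ) + k + α j) ≠ 0 :=
      Finset.prod_ne_zero_iff.2 fun k _ => hpos k j
    have n2 : ∏ k ∈ Finset.range ((i : ℕ) + 1), ((1 : ℝ) + k + α j) ≠ 0 :=
      Finset.prod_ne_zero_iff.2 fun k _ => hpos k j
    rw [Real.rpow_add hs, div_eq_iff n2, ← h]
    rw [← h] at n1
    have n3 := right_ne_zero_of_mul n1
    field_simp
  rw [hM, Matrix.det_mul_column, Matrix.det_mul_row, aux_det _ _ p hd hm]
  rw [Finset.prod_div_distrib, ← Real.rpow_sum_of_pos hs, ← Real.rpow_sum_of_pos hs]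
  have hden : ∏ j : Fin (κ + 1), ∏ k ∈ Finset.range (κ + 1), ((1 : ℝ) + k + α j)
      = ∏ i : Fin (κ + 1), ∏ j : Fin (κ + 1), ((1 : ℝ) + (i : ℕ) + α j) := by
    rw [Finset.prod_comm, Finset.prod_range]
  have hexp : (((κ : ℝ) + 1) * ((κ : ℝ) + 2)) / 2 + ∑ i, α i
      = (∑ i : Fin (κ + 1), ((i : ℕ) : ℝ)) + ∑ j, (1 + α j) := by
    have hs2 : ∀ n : ℕ, ∑ i ∈ Finset.range (n + 1), (i : ℝ) = n * (n + 1) / 2 := by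
      intro n
      induction n with
      | zero => simp
      | succ n ih => rw [Finset.sum_range_succ, ih]; push_cast; ring
    rw [← Finset.sum_range (fun i : ℕ => (i : ℝ)), hs2, Finset.sum_add_distrib]
    simp
    ring
  rw [hden, hexp, Real.rpow_add hs]
  ring
end

section
/- Invertibility of the Wronskian matrix: If in addition the numbers α_0, …, α_κ are pairwise distinct, then for every s > 0 the matrix P(s) is invertible (equivalently det P(s) ≠ 0), and consequently for every d₀ ≥ 1 the Kronecker product W(s) = P(s) ⊗ Id_{d₀} is invertible. -/
open Finset Kronecker

theorem wr_det_ne_zero (κ : ℕ) (α : Fin (κ + 1) → ℝ)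
    (hα : ∀ i, α i ∈ Set.Ioo (-1 : ℝ) 0)
    (hdist : ∀ i j, i ≠ j → α i ≠ α j)
    (s : ℝ) (hs : 0 < s) :
    (Matrix.of fun i j : Fin (κ + 1) =>
        s ^ ((1 : ℝ) + α j + (i : ℕ)) /
          ∏ k ∈ Finset.range ((i : ℕ) + 1), ((1 : ℝ) + (k : ℝ) + α j)).det ≠ 0 := by
  have hpos : ∀ (j : Fin (κ + 1)) (k : ℕ), 0 < (1 : ℝ) + (k : ℝ) + α j := by
    intro j k
    have h1 := (hα j).1
    have h2 : (0 : ℝ) ≤ k := Nat.cast_nonneg k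
    linarith
  let q : Fin (κ + 1) → Polynomial ℝ := fun m =>
    ∏ k ∈ Finset.Ico (κ - (m : ℕ) + 1) (κ + 1), (Polynomial.X + Polynomial.C (1 + (k : ℝ)))
  have hmon : ∀ m, (q m).Monic := fun m =>
    Polynomial.monic_prod_of_monic _ _ fun k _ => Polynomial.monic_X_add_C _
  have hdeg : ∀ m, (q m).natDegree = m := by
    intro m
    have hm := m.2
    simp only [q]
    rw [Polynomial.natDegree_prod_of_monic _ _ fun k _ => Polynomial.monic_X_add_C _]
    simp only [Polynomial.natDegree_X_add_C, Finset.sum_const, Nat.card_Ico, smul_eq_mul]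
    omega
  have hV := Matrix.det_eval_matrixOfPolynomials_eq_det_vandermonde α q hdeg hmon
  have hinj : Function.Injective α := fun i j h => by
    by_contra hne
    exact hdist i j hne h
  have hV0 := Matrix.det_vandermonde_ne_zero_iff.mpr hinj
  rw [hV] at hV0
  set M : Matrix (Fin (κ + 1)) (Fin (κ + 1)) ℝ :=
    Matrix.of fun i j => (q j).eval (α i) with hM
  have key : (Matrix.of fun i j : Fin (κ + 1) =>
        s ^ ((1 : ℝ) + α j + (i : ℕ)) /
          ∏ k ∈ Finset.range ((i : ℕ) + 1), ((1 : ℝ) + (k : ℝ) + α j)) =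
      Matrix.diagonal (fun i : Fin (κ + 1) => s ^ (i : ℕ)) *
        (M.submatrix id (Fin.revPerm : Equiv.Perm (Fin (κ + 1)))).transpose *
      Matrix.diagonal (fun j : Fin (κ + 1) => s ^ ((1 : ℝ) + α j) /
          ∏ k ∈ Finset.range (κ + 1), ((1 : ℝ) + (k : ℝ) + α j)) := by
    ext i j
    rw [Matrix.mul_diagonal, Matrix.diagonal_mul]
    simp only [Matrix.of_apply, Matrix.transpose_apply, Matrix.submatrix_apply, hM, id, q,
      Fin.revPerm_apply, Polynomial.eval_prod, Polynomial.eval_add, Polynomial.eval_X,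
      Polynomial.eval_C, Fin.val_rev]
    have hi := i.2
    have e : κ - (κ + 1 - ((i : ℕ) + 1)) + 1 = (i : ℕ) + 1 := by omega
    rw [e, Real.rpow_add hs, Real.rpow_natCast,
      ← Finset.prod_range_mul_prod_Ico _ (show (i : ℕ) + 1 ≤ κ + 1 by omega)]
    have e2 : ∏ k ∈ Finset.Ico ((i : ℕ) + 1) (κ + 1), (α j + (1 + (k : ℝ))) =
        ∏ k ∈ Finset.Ico ((i : ℕ) + 1) (κ + 1), ((1 : ℝ) + (k : ℝ) + α j) :=
      Finset.prod_congr rfl fun k _ => by ring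
    rw [e2]
    have n1 := (Finset.prod_pos (s := Finset.range ((i : ℕ) + 1)) fun k _ => hpos j k).ne'
    have n2 := (Finset.prod_pos (s := Finset.Ico ((i : ℕ) + 1) (κ + 1))
      fun k _ => hpos j k).ne'
    generalize (∏ k ∈ Finset.Ico ((i : ℕ) + 1) (κ + 1), ((1 : ℝ) + (k : ℝ) + α j)) = B at *
    generalize (∏ k ∈ Finset.range ((i : ℕ) + 1), ((1 : ℝ) + (k : ℝ) + α j)) = A at *
    field_simp
  rw [key, Matrix.det_mul, Matrix.det_mul, Matrix.det_diagonal, Matrix.det_diagonal,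
    Matrix.det_transpose, Matrix.det_permute']
  refine mul_ne_zero (mul_ne_zero ?_ (mul_ne_zero ?_ hV0)) ?_
  · exact Finset.prod_ne_zero_iff.mpr fun i _ => (pow_pos hs _).ne'
  · simp
  · exact Finset.prod_ne_zero_iff.mpr fun j _ =>
      (div_pos (Real.rpow_pos_of_pos hs _) (Finset.prod_pos fun k _ => hpos j k)).ne'

/-- **Invertibility of the Wronskian matrix.**
If the exponents `α₀, …, α_κ ∈ (−1,0)` are pairwise distinct then for every `s > 0`
the matrix `P(s)` with entries `s^{1+α_j+i}/p_{i,j}` is invertible (its determinant is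
nonzero), and consequently for every `d₀ ≥ 1` the Kronecker product
`W(s) = P(s) ⊗ Id_{d₀}` is invertible. -/
theorem wronskian_invertible (κ : ℕ) (α : Fin (κ + 1) → ℝ)
    (hα : ∀ i, α i ∈ Set.Ioo (-1 : ℝ) 0)
    (hdist : ∀ i j, i ≠ j → α i ≠ α j)
    (s : ℝ) (hs : 0 < s) :
    (Matrix.of fun i j : Fin (κ + 1) =>
        s ^ ((1 : ℝ) + α j + (i : ℕ)) /
          ∏ k ∈ Finset.range ((i : ℕ) + 1), ((1 : ℝ) + (k : ℝ) + α j)).det ≠ 0 ∧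
    IsUnit (Matrix.of fun i j : Fin (κ + 1) =>
        s ^ ((1 : ℝ) + α j + (i : ℕ)) /
          ∏ k ∈ Finset.range ((i : ℕ) + 1), ((1 : ℝ) + (k : ℝ) + α j)) ∧
    ∀ d₀ : ℕ, 1 ≤ d₀ →
      IsUnit ((Matrix.of fun i j : Fin (κ + 1) =>
          s ^ ((1 : ℝ) + α j + (i : ℕ)) /
            ∏ k ∈ Finset.range ((i : ℕ) + 1), ((1 : ℝ) + (k : ℝ) + α j)) ⊗ₖ
        (1 : Matrix (Fin d₀) (Fin d₀) ℝ)) := by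
  have h := wr_det_ne_zero κ α hα hdist s hs
  refine ⟨h, (Matrix.isUnit_iff_isUnit_det _).mpr h.isUnit, fun d₀ _ => ?_⟩
  rw [Matrix.isUnit_iff_isUnit_det, Matrix.det_kronecker, Matrix.det_one, one_pow, mul_one]
  exact (pow_ne_zero _ h).isUnit
end

section
/- Endpoint condition for the base-case trajectories (equation (2.4)): Let δ ≠ 0 and let W^δ(1) be the 2d × 2d block matrix [[ Id_d/(1+α_0) , Id_d/(1+α_1) ], [ δ Id_d/((1+α_0)(2+α_0)) , δ Id_d/((1+α_1)(2+α_1)) ]]. Then W^δ(1) is invertible. Moreover, given x^{(0)}, x^{(1)}, x_0^{(0)}, x_0^{(1)} ∈ ℝ^d and times t_*, t_0 with δ = t_0 − t_*, set y^{(0)} := x_0^{(0)} − x^{(0)} and y^{(1)} := x_0^{(1)} − x^{(1)} − δ x^{(0)}, and define (m^{(0)}, m^{(1)}) := W^δ(1)^{−1} (y^{(0)}, y^{(1)}). Then the trajectory X^{(0)}(s) := x^{(0)} + m^{(0)} g_0'(s) + m^{(1)} g_1'(s), X^{(1)}(s) := x^{(1)} + s δ x^{(0)} + δ ( m^{(0)}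 g_0(s) + m^{(1)} g_1(s) ), T(s) := s t_0 + (1−s) t_* satisfies X^{(0)}(1) = x_0^{(0)}, X^{(1)}(1) = x_0^{(1)}, and T(1) = t_0. -/
open Kronecker

/-- **Endpoint condition for the base-case trajectories (equation (2.4)).**
For `δ = t₀ − t_* ≠ 0`, the `2d × 2d` matrix
`W^δ(1) = [[Id/(1+α₀), Id/(1+α₁)],[δ Id/((1+α₀)(2+α₀)), δ Id/((1+α₁)(2+α₁))]]`
is invertible, and with `(m⁰, m¹) := W^δ(1)⁻¹ (y⁰, y¹)` where `y⁰ = x₀⁰ − x⁰`,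
`y¹ = x₀¹ − x¹ − δ x⁰`, the trajectory of the base-case control problem reaches
`X⁰(1) = x₀⁰`, `X¹(1) = x₀¹`, `T(1) = t₀`. -/
theorem base_case_endpoint (d : ℕ) (hd : 1 ≤ d) (α₀ α₁ : ℝ)
    (h₀ : α₀ ∈ Set.Ioo (-1 : ℝ) 0) (h₁ : α₁ ∈ Set.Ioo (-1 : ℝ) 0) (hne : α₀ ≠ α₁)
    (x0 x1 x00 x01 : Fin d → ℝ) (tstar t0 : ℝ) (δ : ℝ) (hδ : δ = t0 - tstar)
    (hδ0 : δ ≠ 0)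
    (Wδ1 : Matrix (Fin 2 × Fin d) (Fin 2 × Fin d) ℝ)
    (hWδ1 : Wδ1 = (Matrix.of
        ![![1 / (1 + α₀), 1 / (1 + α₁)],
          ![δ / ((1 + α₀) * (2 + α₀)), δ / ((1 + α₁) * (2 + α₁))]]) ⊗ₖ
        (1 : Matrix (Fin d) (Fin d) ℝ))
    (y : Fin 2 × Fin d → ℝ)
    (hy : y = fun p => if p.1 = 0 then (x00 - x0) p.2 else (x01 - x1 - δ • x0) p.2)
    (m0 m1 : Fin d → ℝ)
    (hm0 : m0 = fun j => Wδ1⁻¹.mulVec y (0, j))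
    (hm1 : m1 = fun j => Wδ1⁻¹.mulVec y (1, j))
    (G G' : ℝ → ℝ → ℝ)
    (hG : ∀ a s : ℝ, G a s = if s ≤ 0 then 0 else s ^ ((2 : ℝ) + a) / ((1 + a) * (2 + a)))
    (hG' : ∀ a s : ℝ, G' a s = if s ≤ 0 then 0 else s ^ ((1 : ℝ) + a) / (1 + a))
    (X0 X1 : ℝ → Fin d → ℝ) (T : ℝ → ℝ)
    (hX0 : ∀ s, X0 s = x0 + G' α₀ s • m0 + G' α₁ s • m1)
    (hX1 : ∀ s, X1 s = x1 + (s * δ) • x0 + δ • (G α₀ s • m0 + G α₁ s • m1))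
    (hT : ∀ s, T s = s * t0 + (1 - s) * tstar) :
    IsUnit Wδ1 ∧ X0 1 = x00 ∧ X1 1 = x01 ∧ T 1 = t0 := by
  have a0 : 1 + α₀ ≠ 0 := by have := h₀.1; intro h; linarith
  have a1 : 1 + α₁ ≠ 0 := by have := h₁.1; intro h; linarith
  have b0 : 2 + α₀ ≠ 0 := by have := h₀.1; intro h; linarith
  have b1 : 2 + α₁ ≠ 0 := by have := h₁.1; intro h; linarith
  have hdet : IsUnit Wδ1.det := by
    rw [hWδ1, Matrix.det_kronecker, Matrix.det_one, one_pow, mul_one]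
    apply IsUnit.pow
    rw [isUnit_iff_ne_zero, Matrix.det_fin_two]
    simp only [Matrix.of_apply, Matrix.cons_val_zero, Matrix.cons_val_one]
    have e : 1 / (1 + α₀) * (δ / ((1 + α₁) * (2 + α₁))) -
        1 / (1 + α₁) * (δ / ((1 + α₀) * (2 + α₀))) =
        δ * (α₀ - α₁) / ((1 + α₀) * (1 + α₁) * (2 + α₀) * (2 + α₁)) := by
      field_simp
      ring
    rw [e]
    have := sub_ne_zero.mpr hne
    positivity
  have key : Wδ1.mulVec (Wδ1⁻¹.mulVec y) = y := by
    rw [Matrix.mulVec_mulVec, Matrix.mul_nonsing_inv _ hdet, Matrix.one_mulVec]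
  have hrow : ∀ i j, (Matrix.of
        ![![1 / (1 + α₀), 1 / (1 + α₁)],
          ![δ / ((1 + α₀) * (2 + α₀)), δ / ((1 + α₁) * (2 + α₁))]]) i 0 * m0 j +
        (Matrix.of
        ![![1 / (1 + α₀), 1 / (1 + α₁)],
          ![δ / ((1 + α₀) * (2 + α₀)), δ / ((1 + α₁) * (2 + α₁))]]) i 1 * m1 j = y (i, j) := by
    intro i j
    have h := congrFun key (i, j)
    rw [← h, hm0, hm1]
    generalize Wδ1⁻¹.mulVec y = v
    rw [hWδ1]
    simp only [Matrix.mulVec, dotProduct, Fintype.sum_prod_type, Fin.sum_univ_two,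
      Matrix.kroneckerMap_apply, Matrix.one_apply, mul_ite, mul_one, mul_zero, ite_mul, zero_mul,
      Finset.sum_ite_eq, Finset.mem_univ, if_true]
  refine ⟨(Matrix.isUnit_iff_isUnit_det _).mpr hdet, ?_, ?_, ?_⟩
  · funext j
    have h := hrow 0 j
    rw [hy] at h
    simp at h
    rw [hX0, hG', hG', if_neg (by norm_num), if_neg (by norm_num)]
    simp
    linarith
  · funext j
    have h := hrow 1 j
    rw [hy] at h
    simp [-mul_inv_rev, div_eq_mul_inv] at h
    rw [hX1, hG, hG, if_neg (by norm_num), if_neg (by norm_num)]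
    simp [-mul_inv_rev]
    linarith
  · rw [hT]; ring
end

section
/- Explicit gradient of the inverse trajectory map in the base case: Let δ ≠ 0 and for s > 0 let W^δ(s) be the 2d × 2d block matrix [[ s^{1+α_0} Id_d/(1+α_0) , s^{1+α_1} Id_d/(1+α_1) ], [ δ s^{2+α_0} Id_d/((1+α_0)(2+α_0)) , δ s^{2+α_1} Id_d/((1+α_1)(2+α_1)) ]]. Then for every s ∈ (0,1], W^δ(s) is invertible, and for every v ∈ ℝ^d the vector W^δ(1) · (W^δ(s))^{−1} · (v, 0) ∈ ℝ^d × ℝ^d equals ( [ (2+α_0) s^{−1−α_0} − (2+α_1) s^{−1−α_1} ] / (α_0 − α_1) · v , δ [ s^{−1−α_0} − s^{−1−α_1} ] / (α_0 − α_1) · v ). -/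
open Kronecker

/-- **Explicit gradient of the inverse trajectory map in the base case.**
For `δ ≠ 0` and `s ∈ (0,1]`, the `2d × 2d` matrix
`W^δ(s) = [[s^{1+α₀} Id/(1+α₀), s^{1+α₁} Id/(1+α₁)],
          [δ s^{2+α₀} Id/((1+α₀)(2+α₀)), δ s^{2+α₁} Id/((1+α₁)(2+α₁))]]`
is invertible, and for every `v ∈ ℝ^d`,
`W^δ(1)·(W^δ(s))⁻¹·(v,0) = ( [(2+α₀)s^{−1−α₀} − (2+α₁)s^{−1−α₁}]/(α₀−α₁) · v ,
 δ[s^{−1−α₀} − s^{−1−α₁}]/(α₀−α₁) · v )`. -/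
theorem base_case_gradient_inverse (d : ℕ) (hd : 1 ≤ d) (α₀ α₁ : ℝ)
    (h₀ : α₀ ∈ Set.Ioo (-1 : ℝ) 0) (h₁ : α₁ ∈ Set.Ioo (-1 : ℝ) 0) (hne : α₀ ≠ α₁)
    (δ : ℝ) (hδ0 : δ ≠ 0)
    (Wδ : ℝ → Matrix (Fin 2 × Fin d) (Fin 2 × Fin d) ℝ)
    (hWδ : ∀ s : ℝ, Wδ s = (Matrix.of
        ![![s ^ ((1 : ℝ) + α₀) / (1 + α₀), s ^ ((1 : ℝ) + α₁) / (1 + α₁)],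
          ![δ * s ^ ((2 : ℝ) + α₀) / ((1 + α₀) * (2 + α₀)),
            δ * s ^ ((2 : ℝ) + α₁) / ((1 + α₁) * (2 + α₁))]]) ⊗ₖ
        (1 : Matrix (Fin d) (Fin d) ℝ)) :
    ∀ s ∈ Set.Ioc (0 : ℝ) 1,
      IsUnit (Wδ s) ∧
      ∀ v : Fin d → ℝ,
        (Wδ 1).mulVec ((Wδ s)⁻¹.mulVec fun p => if p.1 = 0 then v p.2 else 0) =
          fun p => if p.1 = 0 then
              (((2 + α₀) * s ^ (-(1 : ℝ) - α₀) - (2 + α₁) * s ^ (-(1 : ℝ) - α₁)) /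
                  (α₀ - α₁)) * v p.2
            else
              (δ * (s ^ (-(1 : ℝ) - α₀) - s ^ (-(1 : ℝ) - α₁)) / (α₀ - α₁)) * v p.2 := by
  intro s hs
  have hs0 : 0 < s := hs.1
  have a0 : (1 + α₀) ≠ 0 := by have := h₀.1; intro h; linarith
  have a1 : (1 + α₁) ≠ 0 := by have := h₁.1; intro h; linarith
  have b0 : (2 + α₀) ≠ 0 := by have := h₀.1; intro h; linarith
  have b1 : (2 + α₁) ≠ 0 := by have := h₁.1; intro h; linarith
  have hc : α₀ - α₁ ≠ 0 := sub_ne_zero.mpr hne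
  have e0 : s ^ ((2 : ℝ) + α₀) = s * s ^ ((1 : ℝ) + α₀) := by
    rw [show (2 : ℝ) + α₀ = 1 + (1 + α₀) by ring, Real.rpow_add hs0, Real.rpow_one]
  have e1 : s ^ ((2 : ℝ) + α₁) = s * s ^ ((1 : ℝ) + α₁) := by
    rw [show (2 : ℝ) + α₁ = 1 + (1 + α₁) by ring, Real.rpow_add hs0, Real.rpow_one]
  have f0 : s ^ (-(1 : ℝ) - α₀) = (s ^ ((1 : ℝ) + α₀))⁻¹ := by
    rw [← Real.rpow_neg hs0.le]; congr 1; ring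
  have f1 : s ^ (-(1 : ℝ) - α₁) = (s ^ ((1 : ℝ) + α₁))⁻¹ := by
    rw [← Real.rpow_neg hs0.le]; congr 1; ring
  have p0 : s ^ ((1 : ℝ) + α₀) ≠ 0 := (Real.rpow_pos_of_pos hs0 _).ne'
  have p1 : s ^ ((1 : ℝ) + α₁) ≠ 0 := (Real.rpow_pos_of_pos hs0 _).ne'
  have hW1 := hWδ 1
  have hWs := hWδ s
  rw [e0, e1] at hWs
  simp only [Real.one_rpow] at hW1
  rw [f0, f1]
  generalize s ^ ((1 : ℝ) + α₀) = P at *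
  generalize s ^ ((1 : ℝ) + α₁) = Q at *
  have hU : IsUnit (Wδ s).det := by
    rw [hWs, Matrix.det_kronecker, Matrix.det_fin_two, isUnit_iff_ne_zero]
    simp only [Matrix.det_one, one_pow, mul_one]
    apply pow_ne_zero
    simp only [Matrix.of_apply, Matrix.cons_val_zero, Matrix.cons_val_one, Matrix.cons_val', Matrix.cons_val_fin_one]
    have : P / (1 + α₀) * (δ * (s * Q) / ((1 + α₁) * (2 + α₁))) -
        Q / (1 + α₁) * (δ * (s * P) / ((1 + α₀) * (2 + α₀))) =
        P * Q * δ * s * (α₀ - α₁) / ((1 + α₀) * (1 + α₁) * (2 + α₀) * (2 + α₁)) := by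
      field_simp
      ring
    rw [this]
    have := hs0.ne'
    positivity
  refine ⟨(Matrix.isUnit_iff_isUnit_det _).mpr hU, fun v => ?_⟩
  have key : ∀ (M : Matrix (Fin 2) (Fin 2) ℝ) (f : Fin 2 × Fin d → ℝ) (p : Fin 2 × Fin d),
      (M ⊗ₖ (1 : Matrix (Fin d) (Fin d) ℝ)).mulVec f p
        = M p.1 0 * f (0, p.2) + M p.1 1 * f (1, p.2) := by
    intro M f p
    simp [Matrix.mulVec, dotProduct, Fintype.sum_prod_type, Matrix.kroneckerMap_apply,
      Matrix.one_apply]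
  have hx : (fun p : Fin 2 × Fin d => if p.1 = 0 then v p.2 else 0) =
      (Wδ s).mulVec (fun p => if p.1 = 0 then (1 + α₀) * (2 + α₀) / (α₀ - α₁) * P⁻¹ * v p.2
        else - ((1 + α₁) * (2 + α₁) / (α₀ - α₁) * Q⁻¹ * v p.2)) := by
    funext ⟨i, j⟩
    rw [hWs, key]
    fin_cases i
    · simp
      field_simp
      ring
    · simp
      field_simp
      ring
  rw [hx, Matrix.mulVec_mulVec _ (Wδ s)⁻¹, Matrix.nonsing_inv_mul _ hU, Matrix.one_mulVec]
  funext ⟨i, j⟩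
  rw [hW1, key]
  fin_cases i
  · simp
    field_simp
    ring
  · simp
    field_simp
    ring
end

section
/- Explicit solution of the general control problem (equations (2.6)–(2.7) with d_i = d and B_i = Id): Fix κ ≥ 1, pairwise distinct α_0, …, α_κ ∈ (−1,0), vectors x^{(0)}, …, x^{(κ)}, m^{(0)}, …, m^{(κ)} ∈ ℝ^d, times t_*, t_0, and set δ := t_0 − t_*. For 0 ≤ m ≤ κ+1 and s > 0 write g_i^{(m)}(s) := s^{1+κ+α_i−m} / ∏_{k=1}^{κ+1−m} (k+α_i) (extended by g_i^{(m)}(0) := 0 for m ≤ κ). Define for s ∈ [0,1] and 0 ≤ j ≤ κ: X^{(j)}(s) := x^{(j)} + Σ_{i=1}^{j} ((sδ)^i / i!) x^{(j−i)} + δ^j Σ_{i=0}^{κ} g_i^{(κ−j)}(s) m^{(i)}, and T(s) := s t_0 + (1−s) t_*. Then X^{(j)}(0) = x^{(j)} for all j, T(0) = t_*, and for every s ∈ (0,1): (d/ds) X^{(0)}(s) = Σ_{i=0}^{κ} s^{α_i} m^{(i)}, (d/ds) X^{(j)}(s) = δ X^{(j−1)}(s) for every 1 ≤ j ≤ κ,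 and (d/ds) T(s) = δ; moreover each X^{(j)} is continuous at s = 0. -/
open Finset

theorem gcp_poly {d : ℕ} (x : ℕ → Fin d → ℝ) (δ s : ℝ) (j : ℕ) :
    x j + (∑ i ∈ Finset.Icc 1 j, ((s * δ) ^ i / (Nat.factorial i : ℝ)) • x (j - i))
      = ∑ i ∈ Finset.range (j + 1), ((s * δ) ^ i / (Nat.factorial i : ℝ)) • x (j - i) := by
  rw [Finset.sum_range_succ', add_comm]
  congr 1
  · rw [Finset.range_eq_Ico, Finset.sum_Ico_add' (fun i => ((s * δ) ^ i / (Nat.factorial i : ℝ)) • x (j - i)) 0 j 1]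
    rfl
  · simp

theorem gcp_poly_deriv {d : ℕ} (x : ℕ → Fin d → ℝ) (δ s : ℝ) (n : ℕ) :
    HasDerivAt (fun s : ℝ => ∑ i ∈ Finset.range (n + 1 + 1),
        ((s * δ) ^ i / (Nat.factorial i : ℝ)) • x (n + 1 - i))
      (δ • ∑ i ∈ Finset.range (n + 1), ((s * δ) ^ i / (Nat.factorial i : ℝ)) • x (n - i)) s := by
  have e : (fun s : ℝ => ∑ i ∈ Finset.range (n + 1 + 1),
        ((s * δ) ^ i / (Nat.factorial i : ℝ)) • x (n + 1 - i)) =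
      fun s : ℝ => (∑ i ∈ Finset.range (n + 1),
        ((s * δ) ^ (i + 1) / (Nat.factorial (i + 1) : ℝ)) • x (n - i)) + x (n + 1) := by
    funext s
    rw [Finset.sum_range_succ']
    simp
  rw [e, Finset.smul_sum]
  refine HasDerivAt.add_const _ (HasDerivAt.fun_sum fun i _ => ?_)
  rw [smul_smul]
  refine HasDerivAt.smul_const ?_ _
  have h := ((((hasDerivAt_id s).mul_const δ).pow (i + 1)).div_const (Nat.factorial (i + 1) : ℝ))
  refine h.congr_deriv ?_
  rw [Nat.factorial_succ]
  have : (Nat.factorial i : ℝ) ≠ 0 := by positivity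
  push_cast
  simp
  field_simp

theorem gcp_G_deriv (a s : ℝ) (ha : -1 < a) (hs : 0 < s) (j : ℕ) :
    HasDerivAt (fun s : ℝ => s ^ (1 + (j : ℝ) + a) / ∏ k ∈ Finset.range (j + 1), ((k : ℝ) + 1 + a))
      (s ^ ((j : ℝ) + a) / ∏ k ∈ Finset.range j, ((k : ℝ) + 1 + a)) s := by
  have hp : ∀ k : ℕ, (k : ℝ) + 1 + a ≠ 0 := fun k => by
    have : (0 : ℝ) ≤ k := by positivity
    linarith
  have hP : ∏ k ∈ Finset.range j, ((k : ℝ) + 1 + a) ≠ 0 := Finset.prod_ne_zero_iff.2 fun k _ => hp k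
  refine ((Real.hasDerivAt_rpow_const (p := 1 + (j : ℝ) + a) (Or.inl hs.ne')).div_const _).congr_deriv ?_
  rw [Finset.prod_range_succ, show 1 + (j : ℝ) + a - 1 = j + a by ring,
    show 1 + (j : ℝ) + a = j + 1 + a by ring]
  have := hp j
  field_simp

/-- **Explicit solution of the general control problem (equations (2.6)–(2.7),
with `d_i = d` and `B_i = Id`).**
With `g_i^{(m)}(s) = s^{1+κ+α_i−m}/∏_{k=1}^{κ+1−m}(k+α_i)` for `s > 0` (extended by `0`
for `s ≤ 0`), `δ = t₀ − t_*`, and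
`X^{(j)}(s) = x^{(j)} + Σ_{i=1}^{j} (sδ)^i/i! · x^{(j−i)} + δ^j Σ_{i=0}^{κ} g_i^{(κ−j)}(s) m^{(i)}`,
`T(s) = s t₀ + (1−s) t_*`, the trajectory starts at `(x^{(0)},…,x^{(κ)},t_*)`, and for
`s ∈ (0,1)` satisfies `(X^{(0)})' = Σ_i s^{α_i} m^{(i)}`, `(X^{(j)})' = δ X^{(j−1)}`
for `1 ≤ j ≤ κ`, `T' = δ`; moreover each `X^{(j)}` is continuous from the right
at `s = 0`. -/
theorem general_control_problem (κ : ℕ) (hκ : 1 ≤ κ) (d : ℕ) (hd : 1 ≤ d)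
    (α : Fin (κ + 1) → ℝ) (hα : ∀ i, α i ∈ Set.Ioo (-1 : ℝ) 0)
    (hdist : ∀ i j, i ≠ j → α i ≠ α j)
    (x : ℕ → Fin d → ℝ) (m : Fin (κ + 1) → Fin d → ℝ) (tstar t0 : ℝ)
    (δ : ℝ) (hδ : δ = t0 - tstar)
    (g : Fin (κ + 1) → ℕ → ℝ → ℝ)
    (hg : ∀ (i : Fin (κ + 1)) (mm : ℕ) (s : ℝ), g i mm s =
      if s ≤ 0 then 0
      else s ^ ((1 : ℝ) + (κ : ℝ) + α i - (mm : ℝ)) /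
        ∏ k ∈ Finset.range (κ + 1 - mm), ((k : ℝ) + 1 + α i))
    (X : ℕ → ℝ → Fin d → ℝ)
    (hX : ∀ (j : ℕ) (s : ℝ), X j s =
      x j + (∑ i ∈ Finset.Icc 1 j, ((s * δ) ^ i / (Nat.factorial i : ℝ)) • x (j - i))
        + (δ ^ j) • ∑ i : Fin (κ + 1), g i (κ - j) s • m i)
    (T : ℝ → ℝ) (hT : ∀ s, T s = s * t0 + (1 - s) * tstar) :
    (∀ j ≤ κ, X j 0 = x j) ∧ T 0 = tstar ∧
    (∀ s ∈ Set.Ioo (0 : ℝ) 1,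
      HasDerivAt (X 0) (∑ i : Fin (κ + 1), s ^ (α i) • m i) s ∧
      (∀ j : ℕ, 1 ≤ j → j ≤ κ → HasDerivAt (X j) (δ • X (j - 1) s) s) ∧
      HasDerivAt T δ s) ∧
    (∀ j ≤ κ, ContinuousWithinAt (X j) (Set.Ici 0) 0) := by
  have hXp : ∀ j ≤ κ, ∀ s : ℝ, 0 ≤ s → X j s =
      (∑ i ∈ Finset.range (j + 1), ((s * δ) ^ i / (Nat.factorial i : ℝ)) • x (j - i))
      + (δ ^ j) • ∑ i : Fin (κ + 1), (s ^ (1 + (j : ℝ) + α i) /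
        ∏ k ∈ Finset.range (j + 1), ((k : ℝ) + 1 + α i)) • m i := by
    intro j hj s hs
    rw [hX, gcp_poly]
    congr 2
    refine Finset.sum_congr rfl fun i _ => ?_
    congr 1
    rw [hg]
    rcases hs.eq_or_lt with rfl | hs
    · have : (1 + (j : ℝ) + α i) ≠ 0 := by
        have : (0 : ℝ) ≤ j := by positivity
        have := (hα i).1
        linarith
      simp [Real.zero_rpow this]
    · rw [if_neg (not_le.2 hs), show κ + 1 - (κ - j) = j + 1 by omega, Nat.cast_sub hj]
      congr 2
      ring
  have hX0 : ∀ j ≤ κ, X j 0 = x j := by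
    intro j hj
    rw [hX]
    have h1 : (∑ i ∈ Finset.Icc 1 j, (((0 : ℝ) * δ) ^ i / (Nat.factorial i : ℝ)) • x (j - i)) = 0 := by
      refine Finset.sum_eq_zero fun i hi => ?_
      have : i ≠ 0 := by have := (Finset.mem_Icc.1 hi).1; omega
      simp [this]
    rw [h1]
    simp [hg]
  have hev : ∀ j ≤ κ, ∀ s : ℝ, 0 < s → X j =ᶠ[nhds s] fun s =>
      (∑ i ∈ Finset.range (j + 1), ((s * δ) ^ i / (Nat.factorial i : ℝ)) • x (j - i))
      + (δ ^ j) • ∑ i : Fin (κ + 1), (s ^ (1 + (j : ℝ) + α i) /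
        ∏ k ∈ Finset.range (j + 1), ((k : ℝ) + 1 + α i)) • m i := by
    intro j hj s hs
    filter_upwards [lt_mem_nhds hs] with u hu using hXp j hj u hu.le
  have hGd : ∀ j : ℕ, ∀ s : ℝ, 0 < s → HasDerivAt (fun s : ℝ =>
      (δ ^ j) • ∑ i : Fin (κ + 1), (s ^ (1 + (j : ℝ) + α i) /
        ∏ k ∈ Finset.range (j + 1), ((k : ℝ) + 1 + α i)) • m i)
      ((δ ^ j) • ∑ i : Fin (κ + 1), (s ^ ((j : ℝ) + α i) /
        ∏ k ∈ Finset.range j, ((k : ℝ) + 1 + α i)) • m i) s := fun j s hs =>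
    (HasDerivAt.fun_sum fun i _ =>
      (gcp_G_deriv (α i) s (hα i).1 hs j).smul_const (m i)).const_smul (δ ^ j)
  refine ⟨hX0, by simp [hT], fun s hs => ⟨?_, ?_, ?_⟩, ?_⟩
  · refine HasDerivAt.congr_of_eventuallyEq ?_ (hev 0 (Nat.zero_le _) s hs.1)
    have h := (hGd 0 s hs.1).const_add (x 0)
    simpa using h
  · intro j h1 hj
    obtain ⟨n, rfl⟩ : ∃ n, j = n + 1 := ⟨j - 1, by omega⟩
    refine HasDerivAt.congr_of_eventuallyEq ?_ (hev _ hj s hs.1)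
    rw [Nat.add_sub_cancel, hXp n (by omega) s hs.1.le]
    refine ((gcp_poly_deriv x δ s n).add (hGd (n + 1) s hs.1)).congr_deriv ?_
    rw [smul_add, smul_smul, ← pow_succ']
    congr 2
    refine Finset.sum_congr rfl fun i _ => ?_
    push_cast
    rw [add_comm (n : ℝ) 1]
  · have : T = fun s => s * t0 + (1 - s) * tstar := funext hT
    rw [this, hδ]
    refine (((hasDerivAt_id s).mul_const t0).add
      (((hasDerivAt_id s).const_sub 1).mul_const tstar)).congr_deriv ?_
    ring
  · intro j hj
    refine ContinuousWithinAt.congr (f := fun s =>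
      (∑ i ∈ Finset.range (j + 1), ((s * δ) ^ i / (Nat.factorial i : ℝ)) • x (j - i))
      + (δ ^ j) • ∑ i : Fin (κ + 1), (s ^ (1 + (j : ℝ) + α i) /
        ∏ k ∈ Finset.range (j + 1), ((k : ℝ) + 1 + α i)) • m i) ?_
      (fun u hu => hXp j hj u hu) (hXp j hj 0 le_rfl)
    refine Continuous.continuousWithinAt ?_
    refine Continuous.add (by fun_prop) (Continuous.fun_const_smul ?_ _)
    refine continuous_finset_sum _ fun i _ => Continuous.fun_smul ?_ continuous_const
    refine Continuous.div_const (Real.continuous_rpow_const ?_) _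
    have : (0 : ℝ) ≤ j := by positivity
    have := (hα i).1
    linarith
end

section
/- Three-cylinder splitting inequality (equation (3.1)): Let Q⁺, Q⁻ ⊆ ℝ^{N+1} and Q⁰ ⊆ ℝ^N × ℝ be measurable sets of finite positive Lebesgue measure, write z₀ = (x₀, t₀) for points of Q⁰, and let φ : ℝ^N → [0, ∞) be measurable with |Q⁰|⁻¹ ∫_{Q⁰} φ(x₀) dz₀ = 1. Then for every f integrable on Q⁺ ∪ Q⁻ ∪ Q⁰: |Q⁺|⁻¹ ∫_{Q⁺} ( f(z₊) − |Q⁻|⁻¹ ∫_{Q⁻} f )₊ dz₊ ≤ |Q⁺|⁻¹ ∫_{Q⁺} ( |Q⁰|⁻¹ ∫_{Q⁰} ( f(z₊) − f(z₀) ) φ(x₀) dz₀ )₊ dz₊ + |Q⁻|⁻¹ ∫_{Q⁻} ( |Q⁰|⁻¹ ∫_{Q⁰} ( f(z₀) − f(z₋) ) φ(x₀) dz₀ )₊ dz₋. -/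
open MeasureTheory

/-- **Three-cylinder splitting inequality (equation (3.1)).**
For measurable sets `Q⁺, Q⁻, Q⁰` of finite positive measure, a non-negative
measurable weight `φ` with `⨍_{Q⁰} φ(x₀) dz₀ = 1`, and `f` integrable on
`Q⁺ ∪ Q⁻ ∪ Q⁰` (with `f·φ(x₀)` integrable on `Q⁰`):
`⨍_{Q⁺} (f(z₊) − ⨍_{Q⁻} f)₊ dz₊
  ≤ ⨍_{Q⁺} (⨍_{Q⁰} (f(z₊) − f(z₀)) φ(x₀) dz₀)₊ dz₊
    + ⨍_{Q⁻} (⨍_{Q⁰} (f(z₀) − f(z₋)) φ(x₀) dz₀)₊ dz₋`. -/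
theorem three_cylinder_splitting (N : ℕ) (hN : 1 ≤ N)
    (Qp Qm Q0 : Set ((Fin N → ℝ) × ℝ))
    (hQp : MeasurableSet Qp) (hQm : MeasurableSet Qm) (hQ0 : MeasurableSet Q0)
    (hQp0 : 0 < volume Qp) (hQpfin : volume Qp < ⊤)
    (hQm0 : 0 < volume Qm) (hQmfin : volume Qm < ⊤)
    (hQ00 : 0 < volume Q0) (hQ0fin : volume Q0 < ⊤)
    (φ : (Fin N → ℝ) → ℝ) (hφmeas : Measurable φ) (hφnonneg : ∀ x, 0 ≤ φ x)
    (hφnorm : (volume Q0).toReal⁻¹ * ∫ z in Q0, φ z.1 = 1)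
    (f : (Fin N → ℝ) × ℝ → ℝ)
    (hf : IntegrableOn f (Qp ∪ Qm ∪ Q0))
    (hfφ : IntegrableOn (fun z => f z * φ z.1) Q0) :
    (volume Qp).toReal⁻¹ *
        ∫ z in Qp, max (f z - (volume Qm).toReal⁻¹ * ∫ w in Qm, f w) 0 ≤
      (volume Qp).toReal⁻¹ *
          ∫ z in Qp, max ((volume Q0).toReal⁻¹ * ∫ w in Q0, (f z - f w) * φ w.1) 0 +
      (volume Qm).toReal⁻¹ *
          ∫ z in Qm, max ((volume Q0).toReal⁻¹ * ∫ w in Q0, (f w - f z) * φ w.1) 0 := by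
  have hφi : IntegrableOn (fun z : (Fin N → ℝ) × ℝ => φ z.1) Q0 := by
    by_contra h
    rw [integral_undef h] at hφnorm
    simp at hφnorm
  have hfp : IntegrableOn f Qp := hf.mono_set (fun x hx => Or.inl (Or.inl hx))
  have hfm : IntegrableOn f Qm := hf.mono_set (fun x hx => Or.inl (Or.inr hx))
  obtain ⟨c, hc⟩ : ∃ c, c = (volume Q0).toReal⁻¹ * ∫ w in Q0, f w * φ w.1 := ⟨_, rfl⟩
  have h1 : ∀ a : ℝ, (volume Q0).toReal⁻¹ * ∫ w in Q0, (a - f w) * φ w.1 = a - c := by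
    intro a
    have : ∫ w in Q0, (a - f w) * φ w.1
        = a * (∫ w in Q0, φ w.1) - ∫ w in Q0, f w * φ w.1 := by
      rw [← integral_const_mul, ← integral_sub (hφi.const_mul a) hfφ]
      simp only [sub_mul]
    rw [this, mul_sub, ← hc, mul_left_comm, hφnorm, mul_one]
  have h2 : ∀ a : ℝ, (volume Q0).toReal⁻¹ * ∫ w in Q0, (f w - a) * φ w.1 = c - a := by
    intro a
    have : ∫ w in Q0, (f w - a) * φ w.1
        = (∫ w in Q0, f w * φ w.1) - a * (∫ w in Q0, φ w.1) := by
      rw [← integral_const_mul, ← integral_sub hfφ (hφi.const_mul a)]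
      simp only [sub_mul]
    rw [this, mul_sub, ← hc, mul_left_comm, hφnorm, mul_one]
  simp only [h1, h2]
  have : IsFiniteMeasure (volume.restrict Qp) := ⟨by simpa using hQpfin⟩
  have : IsFiniteMeasure (volume.restrict Qm) := ⟨by simpa using hQmfin⟩
  have hp : 0 < (volume Qp).toReal := ENNReal.toReal_pos hQp0.ne' hQpfin.ne
  have hm : 0 < (volume Qm).toReal := ENNReal.toReal_pos hQm0.ne' hQmfin.ne
  obtain ⟨m, hmd⟩ : ∃ m, m = (volume Qm).toReal⁻¹ * ∫ w in Qm, f w := ⟨_, rfl⟩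
  rw [← hmd]
  have ip : ∀ a : ℝ, Integrable (fun z => max (f z - a) 0) (volume.restrict Qp) := fun a =>
    (Integrable.sub hfp (integrable_const a)).pos_part
  have im : Integrable (fun z => c - f z) (volume.restrict Qm) :=
    Integrable.sub (integrable_const c) hfm
  have imp : Integrable (fun z => max (c - f z) 0) (volume.restrict Qm) := im.pos_part
  have k2 : max (c - m) 0 ≤ (volume Qm).toReal⁻¹ * ∫ z in Qm, max (c - f z) 0 := by
    apply max_le
    · have e : c - m = (volume Qm).toReal⁻¹ * ∫ z in Qm, (c - f z) := by
        rw [integral_sub (integrable_const c) hfm, mul_sub, ← hmd]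
        simp [Measure.real, hm.ne']
      rw [e]
      exact mul_le_mul_of_nonneg_left
        (integral_mono im imp fun z => le_max_left _ _) (inv_nonneg.2 hm.le)
    · exact mul_nonneg (inv_nonneg.2 hm.le) (integral_nonneg fun z => le_max_right _ _)
  -- the integral over `Qp` extends over the whole sum; its second term is a constant
  refine mul_le_mul_of_nonneg_left ?_ (inv_nonneg.2 hp.le)
  refine integral_mono (ip m) ((ip c).add (integrable_const _)) fun z => ?_
  refine le_trans ?_ (add_le_add_right k2 _)
  apply max_le
  · have := le_max_left (f z - c) 0
    have := le_max_left (c - m) 0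
    linarith
  · exact add_nonneg (le_max_right _ _) (le_max_right _ _)
end
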